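/- Let X be a generic m × n matrix over a commutative ring B (entries are independent indeterminates of the polynomial ring B[X]). Regard X = (A B) as a block matrix where A consists of the first a columns. Let J be the ideal of B[X] generated by all t × t minors of X that involve at least r of the first a columns. Then J = I_t(X) ∩ I_r(A), the intersection of the ideal of all t-minors of X with the ideal of all r-minors of A. -/

import Mathlib

noncomputable section

/-- The generic `m × n` matrix: entries are the variables of the polynomial ring
`B[x_{ij}]`. -/
def genMat (B : Type*) [CommRing B] (m n : ℕ) :
    Matrix (Fin m) (Fin n) (MvPolynomial (Fin m × Fin n) B) :=
  fun i j => MvPolynomial.X (i, j)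

/-- The weakly increasing lists of length `d` all of whose heads satisfy `Q`. -/
def stdLists {P : Type*} [PartialOrder P] (Q : P → Prop) (d : ℕ) : Set (List P) :=
  {L | L.Pairwise (· ≤ ·) ∧ L.length = d ∧ ∀ α ∈ L.head?, Q α}

section Straightening

variable {P B S : Type*} [PartialOrder P] [CommRing B] [CommRing S] [Algebra B S]

/-- The span of the standard monomials of degree `d` whose first factor satisfies `Q`. -/
def stdSpan (B : Type*) [CommRing B] [Algebra B S] (δ : P → S) (Q : P → Prop) (d : ℕ) :
    Submodule B S :=
  Submodule.span B ((fun L : List P => (L.map δ).prod) '' stdLists Q d)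

theorem stdSpan_mono (δ : P → S) {Q Q' : P → Prop} (h : ∀ α, Q α → Q' α) (d : ℕ) :
    stdSpan B δ Q d ≤ stdSpan B δ Q' d :=
  Submodule.span_mono (Set.image_mono fun _ hL => ⟨hL.1, hL.2.1, fun α hα => h α (hL.2.2 α hα)⟩)

/-- A straightening relation for every pair `σ ≰ τ` lets one multiply standard monomials. -/
theorem mul_mem_stdSpan [Finite P] (δ : P → S)
    (hδ : ∀ σ τ, ¬ σ ≤ τ → δ σ * δ τ ∈ Submodule.span B {x | ∃ α β, α < σ ∧ x = δ α * δ β})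
    (d : ℕ) : ∀ (σ : P), ∀ x ∈ stdSpan B δ (fun _ => True) d,
      δ σ * x ∈ stdSpan B δ (· ≤ σ) (d + 1) := by
  induction d with
  | zero =>
    intro σ x hx
    induction hx using Submodule.span_induction with
    | zero => simp
    | add x y _ _ hx hy => rw [mul_add]; exact add_mem hx hy
    | smul b x _ hx => rw [mul_smul_comm]; exact Submodule.smul_mem _ _ hx
    | mem x hx =>
      obtain ⟨L, ⟨_, hL, _⟩, rfl⟩ := hx
      obtain rfl := List.length_eq_zero_iff.mp hL
      exact Submodule.subset_span ⟨[σ], ⟨by simp, by simp, by simp⟩, by simp⟩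
  | succ d ih =>
    intro σ
    induction σ using WellFoundedLT.induction with
    | ind σ ihσ =>
    intro x hx
    induction hx using Submodule.span_induction with
    | zero => simp
    | add x y _ _ hx hy => rw [mul_add]; exact add_mem hx hy
    | smul b x _ hx => rw [mul_smul_comm]; exact Submodule.smul_mem _ _ hx
    | mem x hx =>
      obtain ⟨L, ⟨hp, hL, -⟩, rfl⟩ := hx
      obtain ⟨τ, L, rfl⟩ := List.exists_cons_of_length_eq_add_one hL
      have hrest : (L.map δ).prod ∈ stdSpan B δ (fun _ => True) d :=
        Submodule.subset_span ⟨L, ⟨hp.of_cons, by simpa using hL, by simp⟩, rfl⟩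
      by_cases hστ : σ ≤ τ
      · refine Submodule.subset_span ⟨σ :: τ :: L, ⟨?_, by simpa using hL, by simp⟩, by simp⟩
        rw [List.pairwise_cons]
        refine ⟨fun ρ hρ => ?_, hp⟩
        rcases List.mem_cons.mp hρ with rfl | hρ
        · exact hστ
        · exact hστ.trans ((List.pairwise_cons.mp hp).1 ρ hρ)
      · have key : ∀ y ∈ Submodule.span B {x | ∃ α β, α < σ ∧ x = δ α * δ β},
            y * (L.map δ).prod ∈ stdSpan B δ (· ≤ σ) (d + 1 + 1) := by
          intro y hy
          induction hy using Submodule.span_induction with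
          | zero => simp
          | add x y _ _ hx hy => rw [add_mul]; exact add_mem hx hy
          | smul b x _ hx => rw [smul_mul_assoc]; exact Submodule.smul_mem _ _ hx
          | mem x hx =>
            obtain ⟨α, β, hα, rfl⟩ := hx
            rw [mul_assoc]
            exact stdSpan_mono δ (fun γ hγ => le_trans hγ hα.le) _
              (ihσ α hα _ (stdSpan_mono δ (fun _ _ => trivial) _ (ih β _ hrest)))
        simpa [mul_assoc] using key _ (hδ σ τ hστ)

theorem mul_mem_stdSpan_of_le [Finite P] (δ : P → S)
    (hδ : ∀ σ τ, ¬ σ ≤ τ → δ σ * δ τ ∈ Submodule.span B {x | ∃ α β, α < σ ∧ x = δ α * δ β})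
    {Q : P → Prop} (hQ : ∀ α β, α ≤ β → Q β → Q α) {d : ℕ} {σ : P} (hσ : Q σ) {x : S}
    (hx : x ∈ stdSpan B δ (fun _ => True) d) : δ σ * x ∈ stdSpan B δ Q (d + 1) :=
  stdSpan_mono δ (fun α hα => hQ α σ hα hσ) _ (mul_mem_stdSpan δ hδ d σ x hx)

/-- Standard monomials are linearly independent if there are compatible specializations `ε τ`
killing all generators not above `τ` and keeping the generator at `τ` regular. -/
theorem linearIndepOn_stdLists [FaithfulSMul B S] (δ : P → S) (ε : P → S →ₐ[B] S)
    (hkill : ∀ τ σ, ¬ τ ≤ σ → ε τ (δ σ) = 0)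
    (hreg : ∀ τ, IsRegular (ε τ (δ τ)))
    (hcomp : ∀ τ τ', τ ≤ τ' → (ε τ').comp (ε τ) = ε τ') (d : ℕ) :
    LinearIndepOn B (fun L : List P => (L.map δ).prod) (stdLists (fun _ => True) d) := by
  classical
  have main : ∀ (d : ℕ) (φ : S →ₐ[B] S) (U : Set P), (∀ τ ∈ U, (ε τ).comp φ = ε τ) →
      ∀ c : List P →₀ B, (∀ L ∈ c.support, L ∈ stdLists (fun _ => True) d ∧ ∀ α ∈ L, α ∈ U) →
      φ (Finsupp.linearCombination B (fun L : List P => (L.map δ).prod) c) = 0 → c = 0 := by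
    intro d
    induction d with
    | zero =>
      intro φ U _ c hc h0
      have hsupp : c.support ⊆ {[]} := fun L hL => by
        simpa using List.length_eq_zero_iff.mp (hc L hL).1.2.1
      rw [Finsupp.linearCombination_apply, Finsupp.sum_of_support_subset c hsupp _ (by simp)] at h0
      have hnil : c [] = 0 := by
        apply FaithfulSMul.algebraMap_injective B S
        simpa [Algebra.smul_def] using h0
      rw [Finsupp.support_subset_singleton.mp hsupp, hnil, Finsupp.single_zero]
    | succ d ih =>
      intro φ U hU c hc h0
      by_contra hne
      have hcons : ∀ L ∈ c.support, ∃ α L', L = α :: L' := fun L hL =>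
        List.exists_cons_of_length_eq_add_one (hc L hL).1.2.1
      have hheads : (c.support.biUnion fun L => L.head?.toFinset).Nonempty := by
        obtain ⟨L, hL⟩ := Finsupp.support_nonempty_iff.mpr hne
        obtain ⟨α, L', rfl⟩ := hcons L hL
        exact ⟨α, Finset.mem_biUnion.mpr ⟨_, hL, by simp⟩⟩
      obtain ⟨τ, hτ⟩ := Finset.exists_maximal hheads
      obtain ⟨L₀, hL₀, hτ₀⟩ := Finset.mem_biUnion.mp hτ.prop
      obtain ⟨τ₀, L₀, rfl⟩ := hcons L₀ hL₀
      obtain rfl : τ₀ = τ := Eq.symm (by simpa using hτ₀)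
      have hvanish : ∀ α L, α :: L ∈ c.support → α ≠ τ₀ → ε τ₀ (δ α) = 0 := by
        intro α L hL hα
        refine hkill _ _ fun hle => hα ?_
        exact (hτ.eq_of_le (Finset.mem_biUnion.mpr ⟨_, hL, by simp⟩) hle).symm
      have hinj : Set.InjOn (List.cons τ₀) ((List.cons τ₀) ⁻¹' c.support) :=
        fun _ _ _ _ h => (List.cons.inj h).2
      set c' := c.comapDomain (List.cons τ₀) hinj with hc'
      have hτU : τ₀ ∈ U := (hc _ hL₀).2 _ (by simp)
      have hsum : ε τ₀ (δ τ₀) * ε τ₀ (Finsupp.linearCombination B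
          (fun L : List P => (L.map δ).prod) c') = 0 := by
        have h1 : ε τ₀ (Finsupp.linearCombination B (fun L : List P => (L.map δ).prod) c) = 0 := by
          have := congrArg (ε τ₀) h0
          rwa [map_zero, ← AlgHom.comp_apply, hU _ hτU] at this
        rw [← h1, ← map_mul, Finsupp.linearCombination_apply, Finsupp.linearCombination_apply,
          Finsupp.sum, Finsupp.sum, Finset.mul_sum, map_sum, map_sum,
          Finsupp.comapDomain_support, ← Finset.sum_preimage (List.cons τ₀) c.support hinj]
        · refine Finset.sum_congr rfl fun L _ => ?_
          simp [hc', Finsupp.comapDomain_apply]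
        · intro L hL hLr
          obtain ⟨α, L', rfl⟩ := hcons L hL
          have : α ≠ τ₀ := by
            rintro rfl
            exact hLr ⟨L', rfl⟩
          simp [hvanish α L' hL this]
      have hzero := ih (ε τ₀) (Set.Ici τ₀) (fun τ hτ => hcomp _ _ hτ) c' (fun L hL => by
          have hL' : τ₀ :: L ∈ c.support := by simpa [hc'] using hL
          obtain ⟨⟨hp, hlen, -⟩, -⟩ := hc _ hL'
          exact ⟨⟨hp.of_cons, by simpa using hlen, by simp⟩, (List.pairwise_cons.mp hp).1⟩)
        ((hreg τ₀).left.mul_left_eq_zero_iff.mp hsum)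
      have : c (τ₀ :: L₀) = 0 := by simpa [hc'] using DFunLike.congr_fun hzero L₀
      exact Finsupp.mem_support_iff.mp hL₀ this
  refine linearIndepOn_iff.mpr fun c hc h0 => main d (AlgHom.id B S) Set.univ (by simp) c
    (fun L hL => ⟨hc hL, by simp⟩) (by simpa using h0)

end Straightening

/-- Column sets of maximal minors of an `m × N` matrix, ordered componentwise. -/
abbrev ColSet (m N : ℕ) := {c : Fin m → Fin N // StrictMono c}

/-- The maximal minor of `Z` on the columns `c`. -/
def colMinor {R : Type*} [CommRing R] {m N : ℕ} (Z : Matrix (Fin m) (Fin N) R)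
    (c : ColSet m N) : R := (Z.submatrix id c.1).det

section Plucker

variable {R : Type*} [CommRing R] {m N : ℕ}

/-- The determinant with the rows outside `p` frozen, as an alternating map in the other rows. -/
def partialDet (p : Fin m → Prop) [DecidablePred p] (u : Fin m → Fin m → R) :
    (Fin m → R) [⋀^{j // p j}]→ₗ[R] R where
  toFun w := Matrix.detRowAlternating fun j => if h : p j then w ⟨j, h⟩ else u j
  map_update_add' {inst} w i x y := by
    have hup : ∀ z, (fun j => if h : p j then (@Function.update _ _ inst w i z) ⟨j, h⟩ else u j)
        = Function.update (fun j => if h : p j then w ⟨j, h⟩ else u j) i.1 z := by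
      intro z
      funext j
      by_cases hj : j = i.1
      · subst hj; simp [i.2]
      · by_cases h : p j
        · have : (⟨j, h⟩ : {j // p j}) ≠ i := fun e => hj (congrArg Subtype.val e)
          simp [h, hj, Function.update_of_ne this]
        · simp [h, hj]
    simp only [hup, AlternatingMap.map_update_add]
  map_update_smul' {inst} w i x y := by
    have hup : ∀ z, (fun j => if h : p j then (@Function.update _ _ inst w i z) ⟨j, h⟩ else u j)
        = Function.update (fun j => if h : p j then w ⟨j, h⟩ else u j) i.1 z := by
      intro z
      funext j
      by_cases hj : j = i.1
      · subst hj; simp [i.2]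
      · by_cases h : p j
        · have : (⟨j, h⟩ : {j // p j}) ≠ i := fun e => hj (congrArg Subtype.val e)
          simp [h, hj, Function.update_of_ne this]
        · simp [h, hj]
    simp only [hup, AlternatingMap.map_update_smul]
  map_eq_zero_of_eq' w i j hw hij := by
    refine AlternatingMap.map_eq_zero_of_eq _ _ (i := i.1) (j := j.1) ?_
      fun h => hij (Subtype.ext h)
    simp [i.2, j.2, hw]

theorem alternatingMap_eq_zero_of_card_lt {ι : Type*} [Fintype ι] (h : m < Fintype.card ι)
    (F : (Fin m → R) [⋀^ι]→ₗ[R] R) : F = 0 := by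
  refine Module.Basis.ext_alternating (Pi.basisFun R (Fin m)) fun v hv => ?_
  have := Fintype.card_le_of_injective v hv
  simp at this
  omega

/-- Minors on an arbitrary sequence of columns are, up to sign, minors on a column set. -/
theorem det_submatrix_eq_sign_mul (Z : Matrix (Fin m) (Fin N) R) (w : Fin m → Fin N)
    (hw : Function.Injective w) : ∃ (e : Equiv.Perm (Fin m)) (h : StrictMono (w ∘ e)),
      (Z.submatrix id w).det = Equiv.Perm.sign e * colMinor Z ⟨w ∘ e, h⟩ := by
  refine ⟨Tuple.sort w, (Tuple.monotone_sort w).strictMono_of_injective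
    (hw.comp (Equiv.injective _)), ?_⟩
  have h := Matrix.det_permute' (Tuple.sort w) (Z.submatrix id w)
  rw [Matrix.submatrix_submatrix, Function.comp_id] at h
  rw [colMinor, h, ← mul_assoc]
  norm_cast
  simp

/-- Replacing some entries of `σ` at positions `≥ k` by values `< σ k` gives a smaller column
set. -/
theorem sort_lt_of_exchange (σ : ColSet m N) (k : Fin m) (w : Fin m → Fin N)
    (hlt : ∀ j < k, w j = σ.1 j)
    (hge : ∀ j, k ≤ j → w j < σ.1 k ∨ ∃ i, k ≤ i ∧ w j = σ.1 i)
    (hex : ∃ j, k ≤ j ∧ w j < σ.1 k)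
    (e : Equiv.Perm (Fin m)) (h : StrictMono (w ∘ e)) :
    (⟨w ∘ e, h⟩ : ColSet m N) < σ := by
  have hinj : Function.Injective w := by
    have := h.injective.comp e.symm.injective
    simpa [Function.comp_assoc] using this
  refine lt_of_le_of_ne ?_ ?_
  · intro j
    show w (e j) ≤ σ.1 j
    by_contra! hcon
    rcases lt_or_ge j k with hj | hj
    · -- the values `σ 0, …, σ j` all precede `w (e j)`
      have : ∀ i : Finset.Iic j, e.symm i.1 ∈ Finset.Iio j := by
        rintro ⟨i, hi⟩
        rw [Finset.mem_Iic] at hi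
        rw [Finset.mem_Iio]
        have hw : w (e (e.symm i)) < w (e j) := by
          rw [Equiv.apply_symm_apply, hlt i (hi.trans_lt hj)]
          exact (σ.2.monotone hi).trans_lt hcon
        exact h.lt_iff_lt.mp hw
      have hc := Finset.card_le_card_of_injOn (s := Finset.Iic j) (t := Finset.Iio j) e.symm
        (fun i hi => this ⟨i, hi⟩) e.symm.injective.injOn
      simp at hc
    · have : ∀ i, j ≤ i → ∃ l, j < l ∧ w (e i) = σ.1 l := by
        intro i hi
        have hw : σ.1 j < w (e i) := hcon.trans_le (h.monotone hi)
        have hk : σ.1 k ≤ σ.1 j := σ.2.monotone hj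
        rcases lt_or_ge (e i) k with hik | hik
        · rw [hlt _ hik] at hw
          exact absurd (σ.2.lt_iff_lt.mp hw) (by omega)
        · rcases hge _ hik with h' | ⟨l, -, hl⟩
          · exact absurd (hw.trans h') (not_lt.mpr hk)
          · exact ⟨l, σ.2.lt_iff_lt.mp (hl ▸ hw), hl⟩
      choose! f hf1 hf2 using this
      have hc := Finset.card_le_card_of_injOn (s := Finset.Ici j) (t := Finset.Ioi j) f
        (fun i hi => by simpa using hf1 i (by simpa using hi)) (by
          intro a ha b hb hab
          have ha' := hf2 a (by simpa using ha)
          have hb' := hf2 b (by simpa using hb)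
          exact e.injective (hinj (by rw [ha', hb', hab])))
      simp at hc
      omega
  · intro heq
    obtain ⟨j, hkj, hj⟩ := hex
    have h1 : w j = σ.1 (e.symm j) := by
      have := congrFun (congrArg Subtype.val heq) (e.symm j)
      simpa using this
    have h2 : e.symm j < k := σ.2.lt_iff_lt.mp (h1 ▸ hj)
    have h3 := hinj (h1.trans (hlt _ h2).symm)
    omega

theorem colMinor_mul_colMinor_mem_span {B : Type*} [CommRing B] [Algebra B R]
    (Z : Matrix (Fin m) (Fin N) R) (σ τ : ColSet m N) (hστ : ¬ σ ≤ τ) :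
    colMinor Z σ * colMinor Z τ ∈
      Submodule.span B {x | ∃ α β, α < σ ∧ x = colMinor Z α * colMinor Z β} := by
  classical
  obtain ⟨k, hk⟩ : ∃ k, τ.1 k < σ.1 k := by
    by_contra! h
    exact hστ h
  set W := Submodule.span B {x | ∃ α β, α < σ ∧ x = colMinor Z α * colMinor Z β}
  let Zc : Fin N → Fin m → R := fun c i => Z i c
  let a := partialDet (fun j => k ≤ j) (fun j => Zc (σ.1 j))
  let b := partialDet (fun j => j ≤ k) (fun j => Zc (τ.1 j))
  let F := (LinearMap.mul' R R).compAlternatingMap (a.domCoprod b)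
  let u : {j // k ≤ j} ⊕ {j // j ≤ k} → Fin N := Sum.elim (fun j => σ.1 j) (fun j => τ.1 j)
  have hF : F = 0 := by
    apply alternatingMap_eq_zero_of_card_lt
    rw [Fintype.card_sum, Fintype.card_subtype, Fintype.card_subtype]
    have h1 : (Finset.univ.filter fun j : Fin m => k ≤ j) = Finset.Ici k := by ext; simp
    have h2 : (Finset.univ.filter fun j : Fin m => j ≤ k) = Finset.Iic k := by ext; simp
    rw [h1, h2]
    simp
    omega
  -- the two sequences of columns occurring in the summand of a permutation
  let wa : Equiv.Perm ({j // k ≤ j} ⊕ {j // j ≤ k}) → Fin m → Fin N := fun π j =>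
    if h : k ≤ j then u (π (Sum.inl ⟨j, h⟩)) else σ.1 j
  let wb : Equiv.Perm ({j // k ≤ j} ⊕ {j // j ≤ k}) → Fin m → Fin N := fun π j =>
    if h : j ≤ k then u (π (Sum.inr ⟨j, h⟩)) else τ.1 j
  have hsummand : ∀ π, LinearMap.mul' R R (AlternatingMap.domCoprod.summand a b
      (Quotient.mk'' π) fun i => Zc (u i)) =
      Equiv.Perm.sign π • ((Z.submatrix id (wa π)).det * (Z.submatrix id (wb π)).det) := by
    intro π
    have ha : a (fun i => Zc (u (π (Sum.inl i)))) = (Z.submatrix id (wa π)).det := by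
      rw [← Matrix.det_transpose]
      show Matrix.det _ = Matrix.det _
      congr 1
      funext j i
      show (if h : k ≤ j then Zc (u (π (Sum.inl ⟨j, h⟩))) else Zc (σ.1 j)) i = Z i (wa π j)
      by_cases h : k ≤ j <;> simp [wa, Zc, h]
    have hb : b (fun i => Zc (u (π (Sum.inr i)))) = (Z.submatrix id (wb π)).det := by
      rw [← Matrix.det_transpose]
      show Matrix.det _ = Matrix.det _
      congr 1
      funext j i
      show (if h : j ≤ k then Zc (u (π (Sum.inr ⟨j, h⟩))) else Zc (τ.1 j)) i = Z i (wb π j)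
      by_cases h : j ≤ k <;> simp [wb, Zc, h]
    rw [AlternatingMap.domCoprod.summand_mk'', smul_apply,
      MultilinearMap.domDomCongr_apply, MultilinearMap.domCoprod_apply, ← ha, ← hb,
      Units.smul_def, map_zsmul]
    rfl
  have hsum : ∑ q, LinearMap.mul' R R (AlternatingMap.domCoprod.summand a b q
      fun i => Zc (u i)) = 0 := by
    have := DFunLike.congr_fun hF fun i => Zc (u i)
    simpa [F, AlternatingMap.domCoprod_apply] using this
  replace hsum := (Finset.add_sum_erase _ _ (Finset.mem_univ
    (Quotient.mk'' 1 : Equiv.Perm.ModSumCongr {j // k ≤ j} {j // j ≤ k}))).trans hsum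
  rw [hsummand 1] at hsum
  have hwa : wa 1 = σ.1 := by
    funext j
    by_cases h : k ≤ j <;> simp [wa, u, h]
  have hwb : wb 1 = τ.1 := by
    funext j
    by_cases h : j ≤ k <;> simp [wb, u, h]
  rw [hwa, hwb, Equiv.Perm.sign_one, one_smul] at hsum
  rw [colMinor, colMinor, eq_neg_of_add_eq_zero_left hsum]
  refine neg_mem (sum_mem fun q hq => ?_)
  induction q using Quotient.inductionOn' with | _ π
  rw [hsummand, Units.smul_def]
  refine zsmul_mem ?_ _
  by_cases hia : Function.Injective (wa π)
  swap
  · obtain ⟨i, j, hij, hne⟩ := Function.not_injective_iff.mp hia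
    rw [Matrix.det_zero_of_column_eq hne (fun l => by simp [hij]), zero_mul]
    exact zero_mem _
  by_cases hib : Function.Injective (wb π)
  swap
  · obtain ⟨i, j, hij, hne⟩ := Function.not_injective_iff.mp hib
    rw [Matrix.det_zero_of_column_eq (M := Z.submatrix id (wb π)) hne (fun l => by simp [hij]),
      mul_zero]
    exact zero_mem _
  obtain ⟨e, he, hea⟩ := det_submatrix_eq_sign_mul Z _ hia
  obtain ⟨e', he', heb⟩ := det_submatrix_eq_sign_mul Z _ hib
  rw [hea, heb, mul_mul_mul_comm, ← Int.cast_mul, ← zsmul_eq_mul]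
  refine zsmul_mem ?_ _
  refine Submodule.subset_span ⟨⟨_, he⟩, ⟨_, he'⟩, ?_, rfl⟩
  have hu : ∀ i, u (Sum.inr i) < σ.1 k := fun i => (τ.2.monotone i.2).trans_lt hk
  refine sort_lt_of_exchange σ k _ (fun j hj => by simp [wa, not_le.mpr hj]) ?_ ?_ _ _
  · intro j hj
    simp only [wa, hj, dif_pos]
    rcases π (Sum.inl ⟨j, hj⟩) with i | i
    · exact Or.inr ⟨i, i.2, rfl⟩
    · exact Or.inl (hu i)
  · by_contra! hcon
    refine (Finset.mem_erase.mp hq).1 (Quotient.sound' ?_)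
    rw [QuotientGroup.leftRel_apply, mul_one]
    refine inv_mem (Equiv.Perm.mem_sumCongrHom_range_of_perm_mapsTo_inl ?_)
    rintro _ ⟨⟨j, hj⟩, rfl⟩
    have := hcon j hj
    simp only [wa, hj, dif_pos] at this
    rcases hπ : π (Sum.inl ⟨j, hj⟩) with i | i
    · exact ⟨i, rfl⟩
    · rw [hπ] at this
      exact absurd (hu i) (not_lt.mpr this)

end Plucker

theorem AlgHom.map_colMinor {B R R' : Type*} [CommRing B] [CommRing R] [CommRing R'] [Algebra B R]
    [Algebra B R'] {m N : ℕ} (φ : R →ₐ[B] R') (Z : Matrix (Fin m) (Fin N) R) (c : ColSet m N) :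
    φ (colMinor Z c) = colMinor (Z.map φ) c :=
  φ.map_det _

theorem colMinor_mul {R : Type*} [CommRing R] {m N : ℕ} (A : Matrix (Fin m) (Fin m) R)
    (Z : Matrix (Fin m) (Fin N) R) (c : ColSet m N) :
    colMinor (A * Z) c = A.det * colMinor Z c := by
  rw [colMinor, colMinor, ← Matrix.det_mul]
  rfl

section Independence

variable (B : Type*) [CommRing B] (m n : ℕ)

/-- The specialization of the generic matrix to echelon form with pivots `τ`. -/
def echelonSpec (N : ℕ) (τ : ColSet m N) :
    MvPolynomial (Fin m × Fin N) B →ₐ[B] MvPolynomial (Fin m × Fin N) B :=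
  MvPolynomial.aeval fun p => if τ.1 p.1 ≤ p.2 then MvPolynomial.X p else 0

theorem echelonSpec_colMinor (N : ℕ) (τ σ : ColSet m N) :
    echelonSpec B m N τ (colMinor (genMat B m N) σ) = Matrix.det (Matrix.of fun i j : Fin m =>
      if τ.1 i ≤ σ.1 j then (MvPolynomial.X (i, σ.1 j) : MvPolynomial (Fin m × Fin N) B)
      else 0) := by
  rw [AlgHom.map_colMinor, colMinor]
  congr 1
  ext1 i j
  simp [genMat, echelonSpec]

theorem linearIndepOn_genMat_minors (N d : ℕ) :
    LinearIndepOn B (fun L : List (ColSet m N) => (L.map (colMinor (genMat B m N))).prod)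
      (stdLists (fun _ => True) d) := by
  refine linearIndepOn_stdLists _ (echelonSpec B m N) ?_ ?_ ?_ d
  · intro τ σ hτσ
    rw [echelonSpec_colMinor, Matrix.det_apply]
    refine Finset.sum_eq_zero fun π _ => ?_
    rw [smul_eq_zero_of_right]
    by_contra hne
    rw [← ne_eq] at hne
    have hle : ∀ i, τ.1 (π i) ≤ σ.1 i := by
      intro i
      by_contra h
      exact hne (Finset.prod_eq_zero (Finset.mem_univ i) (by simp [h]))
    refine hτσ fun k => ?_
    by_contra! hk
    have hlt : ∀ i ∈ Finset.Iic k, π i ∈ Finset.Iio k := by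
      intro i hi
      rw [Finset.mem_Iic] at hi
      rw [Finset.mem_Iio]
      exact τ.2.lt_iff_lt.mp (((hle i).trans (σ.2.monotone hi)).trans_lt hk)
    have := Finset.card_le_card_of_injOn π hlt π.injective.injOn
    simp at this
  · intro τ
    rw [echelonSpec_colMinor, Matrix.det_of_isUpperTriangular]
    · simp only [Matrix.of_apply, le_refl, if_true]
      exact IsRegular.prod fun _ _ => MvPolynomial.isRegular_X
    · intro i j hij
      have : τ.1 j < τ.1 i := τ.2 hij
      simp [this.not_ge]
  · intro τ τ' h
    refine MvPolynomial.algHom_ext fun p => ?_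
    by_cases h1 : τ.1 p.1 ≤ p.2
    · simp [echelonSpec, h1]
    · have : ¬ τ'.1 p.1 ≤ p.2 := fun h2 => h1 ((h p.1).trans h2)
      simp [echelonSpec, h1, this]

/-- The generic matrix extended by an identity matrix. Its maximal minors are, up to sign, all
minors of the generic matrix. -/
def extMat : Matrix (Fin m) (Fin (n + m)) (MvPolynomial (Fin m × Fin n) B) :=
  fun i => Fin.append (genMat B m n i) ((1 : Matrix (Fin m) (Fin m) _) i)

/-- The set of the last `m` columns. -/
def lastCols : ColSet m (n + m) := ⟨Fin.natAdd n, Fin.strictMono_natAdd n⟩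

theorem le_lastCols (c : ColSet m (n + m)) : c ≤ lastCols m n := by
  intro j
  show c.1 j ≤ Fin.natAdd n j
  have hc := Finset.card_le_card_of_injOn (s := Finset.Ioi j) (t := Finset.Ioi (c.1 j)) c.1
    (fun i hi => by simpa using c.2 (by simpa using hi)) c.2.injective.injOn
  simp only [Fin.card_Ioi] at hc
  have := (c.1 j).2
  rw [Fin.le_def, Fin.val_natAdd]
  omega

theorem colMinor_extMat_lastCols : colMinor (extMat B m n) (lastCols m n) = 1 := by
  rw [colMinor, ← Matrix.det_one (n := Fin m)]
  congr 1
  ext1 i j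
  simp [extMat, lastCols, Matrix.submatrix_apply]
  rfl

theorem linearIndepOn_extMat_minors (d : ℕ) :
    LinearIndepOn B (fun L : List (ColSet m (n + m)) => (L.map (colMinor (extMat B m n))).prod)
      (stdLists (fun _ => True) d) := by
  classical
  let Z := genMat B m (n + m)
  let D := colMinor Z (lastCols m n)
  let S := Localization.Away D
  let ι : MvPolynomial (Fin m × Fin (n + m)) B →ₐ[B] S := IsScalarTower.toAlgHom B _ S
  let W : Matrix (Fin m) (Fin (n + m)) S := Z.map ι
  let W₂ := W.submatrix id (Fin.natAdd n)
  have hdet : W₂.det = ι D := (ι.map_colMinor Z (lastCols m n)).symm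
  have hunit : IsUnit W₂.det := hdet ▸ IsLocalization.Away.algebraMap_isUnit D
  let φ : MvPolynomial (Fin m × Fin n) B →ₐ[B] S :=
    MvPolynomial.aeval fun p => (W₂⁻¹ * W) p.1 (Fin.castAdd m p.2)
  have hφ : (extMat B m n).map φ = W₂⁻¹ * W := by
    ext i j
    induction j using Fin.addCases with
    | left j => simp [extMat, genMat, φ]
    | right j =>
      have h1 : (W₂⁻¹ * W) i (Fin.natAdd n j) = (W₂⁻¹ * W₂) i j := rfl
      rw [h1, Matrix.nonsing_inv_mul _ hunit]
      by_cases hij : i = j <;> simp [extMat, Matrix.one_apply, hij]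
  have hminor : ∀ c, φ (colMinor (extMat B m n) c) = W₂⁻¹.det * ι (colMinor Z c) := fun c => by
    rw [AlgHom.map_colMinor, AlgHom.map_colMinor, hφ, colMinor_mul]
  have hprod : ∀ L : List (ColSet m (n + m)), φ (L.map (colMinor (extMat B m n))).prod =
      W₂⁻¹.det ^ L.length * ι (L.map (colMinor Z)).prod := by
    intro L
    induction L with
    | nil => simp
    | cons c L ih =>
      rw [List.map_cons, List.prod_cons, map_mul, ih, hminor, List.map_cons, List.prod_cons,
        map_mul, List.length_cons]
      ring
  refine linearIndepOn_iff.mpr fun c hc h0 => ?_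
  have hlen : ∀ L ∈ c.support, L.Pairwise (· ≤ ·) ∧ L.length = d := fun L hL =>
    ⟨(hc hL).1, (hc hL).2.1⟩
  have h1 : W₂⁻¹.det ^ d *
      ι (Finsupp.linearCombination B (fun L => (L.map (colMinor Z)).prod) c) = 0 := by
    rw [← map_zero φ, ← h0, Finsupp.linearCombination_apply, Finsupp.linearCombination_apply,
      Finsupp.sum, Finsupp.sum, map_sum, map_sum, Finset.mul_sum]
    refine Finset.sum_congr rfl fun L hL => ?_
    rw [map_smul, map_smul, hprod, (hlen L hL).2, mul_smul_comm]
  have hunit' : IsUnit (W₂⁻¹.det ^ d) :=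
    IsUnit.pow _ ((Matrix.isUnit_nonsing_inv_det_iff).mpr hunit)
  have h2 := hunit'.mul_right_eq_zero.mp h1
  obtain ⟨⟨_, N, rfl⟩, hN⟩ := (IsLocalization.map_eq_zero_iff (Submonoid.powers D) S _).mp h2
  let ap : List (ColSet m (n + m)) → List (ColSet m (n + m)) :=
    fun L => L ++ List.replicate N (lastCols m n)
  have hap : Function.Injective ap := fun L L' h => List.append_cancel_right h
  have h3 := linearIndepOn_iff.mp (linearIndepOn_genMat_minors B m (n + m) (d + N))
    (c.mapDomain ap) ?_ ?_
  · exact (Finsupp.mapDomain_injective hap) (h3.trans Finsupp.mapDomain_zero.symm)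
  · intro L hL
    obtain ⟨L, hLc, rfl⟩ := Finset.mem_image.mp (Finsupp.mapDomain_support hL)
    refine ⟨List.pairwise_append.mpr ⟨(hlen L hLc).1, ?_, ?_⟩, ?_, by simp⟩
    · exact List.pairwise_replicate.mpr (Or.inr le_rfl)
    · intro α _ β hβ
      rw [List.eq_of_mem_replicate hβ]
      exact le_lastCols m n α
    · simp [ap, (hlen L hLc).2]
  · rw [Finsupp.linearCombination_mapDomain, ← hN, Finsupp.linearCombination_apply,
      Finsupp.linearCombination_apply, Finsupp.sum, Finsupp.sum, Finset.mul_sum]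
    refine Finset.sum_congr rfl fun L _ => ?_
    simp [ap, D, Z, mul_comm]

end Independence

/-- If all minors of the first `t` columns of a square matrix lie in an ideal, then so does its
determinant. -/
theorem det_mem_of_minors_mem {R : Type*} [CommRing R] (I : Ideal R) {t s : ℕ} (h : t ≤ s)
    (M : Matrix (Fin s) (Fin s) R)
    (hM : ∀ f : Fin t → Fin s, StrictMono f → (M.submatrix f (Fin.castLE h)).det ∈ I) :
    M.det ∈ I := by
  induction s, h using Nat.le_induction with
  | base => exact hM id strictMono_id
  | succ s h ih =>
    rw [Matrix.det_succ_column M (Fin.last s)]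
    refine sum_mem fun i _ => Ideal.mul_mem_left _ _ (ih _ fun f hf => ?_)
    have := hM (i.succAbove ∘ f) ((Fin.strictMono_succAbove i).comp hf)
    rw [Matrix.submatrix_submatrix]
    convert this using 3
    ext1 j
    simp

section Ideals

variable (B : Type*) [CommRing B] (m n : ℕ)

/-- The first `k` columns in the column set have index less than `b`. -/
def FirstLT {m N : ℕ} (k b : ℕ) (σ : ColSet m N) : Prop :=
  ∀ i : Fin m, (i : ℕ) < k → (σ.1 i : ℕ) < b

theorem FirstLT.of_le {m N k b : ℕ} {α β : ColSet m N} (h : α ≤ β) (hβ : FirstLT k b β) :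
    FirstLT k b α := fun i hi => (Fin.le_def.mp (h i)).trans_lt (hβ i hi)

theorem minor_eq_colMinor_extMat {s b : ℕ} (f : Fin s → Fin m) (g : Fin s → Fin n)
    (hf : StrictMono f) (hg : StrictMono g) (hb : ∀ i, (g i : ℕ) < b) :
    ∃ (u : ℤ) (σ : ColSet m (n + m)), FirstLT s b σ ∧
      ((genMat B m n).submatrix f g).det = u * colMinor (extMat B m n) σ := by
  classical
  let e₀ : Fin s ⊕ {i // i ∉ Set.range f} ≃ Fin m :=
    (Equiv.sumCongr (Equiv.ofInjective f hf.injective) (Equiv.refl _)).trans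
      (Equiv.Set.sumCompl (Set.range f))
  have he₀l : ∀ i, e₀ (Sum.inl i) = f i := fun i => rfl
  have he₀r : ∀ i, e₀ (Sum.inr i) = i.1 := fun i => rfl
  let w₀ : Fin s ⊕ {i // i ∉ Set.range f} → Fin (n + m) :=
    Sum.elim (fun i => Fin.castAdd m (g i)) (fun i => Fin.natAdd n i.1)
  have hw₀ : Function.Injective w₀ := by
    rintro (i | i) (j | j) h
    · exact congrArg _ (hg.injective (Fin.castAdd_injective _ _ h))
    · have := congrArg Fin.val h
      simp [w₀] at this
      omega
    · have := congrArg Fin.val h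
      simp [w₀] at this
      omega
    · exact congrArg _ (Subtype.ext (Fin.natAdd_injective _ _ h))
  obtain ⟨e, he, hdet⟩ := det_submatrix_eq_sign_mul (extMat B m n) (w₀ ∘ e₀.symm)
    (hw₀.comp e₀.symm.injective)
  refine ⟨Equiv.Perm.sign e, ⟨_, he⟩, ?_, ?_⟩
  · intro i hi
    by_contra! hcon
    have hlt : ∀ l ∈ (Finset.univ : Finset (Fin s)),
        e.symm (e₀ (Sum.inl l)) ∈ Finset.Iio i := by
      intro l _
      rw [Finset.mem_Iio, ← he.lt_iff_lt, Fin.lt_def]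
      refine lt_of_lt_of_le ?_ hcon
      simpa [w₀] using hb l
    have := Finset.card_le_card_of_injOn _ hlt
      ((e.symm.injective.comp (e₀.injective.comp Sum.inl_injective)).injOn)
    simp at this
    omega
  · rw [← hdet, ← Matrix.det_submatrix_equiv_self e₀, Matrix.submatrix_submatrix]
    have hblock : (extMat B m n).submatrix (id ∘ e₀) ((w₀ ∘ e₀.symm) ∘ e₀) =
        Matrix.fromBlocks ((genMat B m n).submatrix f g) 0
          ((genMat B m n).submatrix (fun i : {i // i ∉ Set.range f} => i.1) g) 1 := by
      have hw : (w₀ ∘ e₀.symm) ∘ e₀ = w₀ := by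
        funext x
        simp
      rw [hw]
      ext1 i j
      rcases i with i | i <;> rcases j with j | j
      · simp [w₀, extMat, he₀l]
      · have : f i ≠ j.1 := fun h => j.2 ⟨i, h⟩
        simp [w₀, extMat, he₀l, this]
      · simp [w₀, extMat, he₀r]
      · simp only [Matrix.submatrix_apply, Function.comp_apply, id, he₀r, w₀, Sum.elim_inr,
          extMat, Fin.append_right, Matrix.fromBlocks_apply₂₂, Matrix.one_apply, Subtype.ext_iff]
    rw [hblock, Matrix.det_fromBlocks_zero₁₂, Matrix.det_one, mul_one]

theorem exists_mem_stdSpan (p : MvPolynomial (Fin m × Fin n) B) :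
    ∃ D, ∀ d, D ≤ d → p ∈ stdSpan B (colMinor (extMat B m n)) (fun _ => True) d := by
  have hmul : ∀ σ d, ∀ x ∈ stdSpan B (colMinor (extMat B m n)) (fun _ => True) d,
      colMinor (extMat B m n) σ * x ∈
        stdSpan B (colMinor (extMat B m n)) (fun _ => True) (d + 1) := fun σ d x hx =>
    mul_mem_stdSpan_of_le _ (colMinor_mul_colMinor_mem_span _) (fun _ _ _ _ => trivial) trivial hx
  induction p using MvPolynomial.induction_on with
  | C b =>
    refine ⟨0, fun d _ => ?_⟩
    induction d with
    | zero =>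
      have : MvPolynomial.C b = b • (([] : List (ColSet m (n + m))).map
          (colMinor (extMat B m n))).prod := by
        simp [MvPolynomial.smul_eq_C_mul]
      rw [this]
      exact Submodule.smul_mem _ _ (Submodule.subset_span ⟨[], ⟨by simp, rfl, by simp⟩, rfl⟩)
    | succ d ih =>
      simpa [colMinor_extMat_lastCols] using hmul (lastCols m n) d _ (ih (Nat.zero_le _))
  | add p q hp hq =>
    obtain ⟨D, hD⟩ := hp
    obtain ⟨D', hD'⟩ := hq
    exact ⟨max D D', fun d hd => add_mem (hD d (le_of_max_le_left hd))
      (hD' d (le_of_max_le_right hd))⟩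
  | mul_X p ij hp =>
    obtain ⟨D, hD⟩ := hp
    obtain ⟨u, σ, -, hσ⟩ := minor_eq_colMinor_extMat B m n (b := n)
      (fun _ : Fin 1 => ij.1) (fun _ => ij.2) (Subsingleton.strictMono _)
      (Subsingleton.strictMono _) (fun _ => ij.2.2)
    have hX : MvPolynomial.X ij = (u : MvPolynomial (Fin m × Fin n) B) *
        colMinor (extMat B m n) σ := by
      rw [← hσ, Matrix.det_fin_one]
      rfl
    refine ⟨D + 1, fun d hd => ?_⟩
    obtain ⟨d, rfl⟩ : ∃ d', d = d' + 1 := ⟨d - 1, by omega⟩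
    rw [mul_comm, hX, mul_assoc, ← zsmul_eq_mul]
    exact zsmul_mem (hmul σ d p (hD d (by omega))) _

theorem exists_mem_stdSpan_of_mem_span {k b : ℕ} {p : MvPolynomial (Fin m × Fin n) B}
    {T : Set (MvPolynomial (Fin m × Fin n) B)}
    (hT : ∀ x ∈ T, ∃ (f : Fin k → Fin m) (g : Fin k → Fin n), StrictMono f ∧ StrictMono g ∧
      (∀ i, (g i : ℕ) < b) ∧ x = ((genMat B m n).submatrix f g).det)
    (hp : p ∈ Ideal.span T) :
    ∃ D, ∀ d, D ≤ d → p ∈ stdSpan B (colMinor (extMat B m n)) (FirstLT k b) (d + 1) := by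
  induction hp using Submodule.closure_induction with
  | zero => exact ⟨0, fun _ _ => zero_mem _⟩
  | add p q _ _ hp hq =>
    obtain ⟨D, hD⟩ := hp
    obtain ⟨D', hD'⟩ := hq
    exact ⟨max D D', fun d hd => add_mem (hD d (le_of_max_le_left hd))
      (hD' d (le_of_max_le_right hd))⟩
  | smul_mem c x hx =>
    obtain ⟨f, g, hf, hg, hb, rfl⟩ := hT x hx
    obtain ⟨u, σ, hσ, hdet⟩ := minor_eq_colMinor_extMat B m n f g hf hg hb
    obtain ⟨D, hD⟩ := exists_mem_stdSpan B m n c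
    refine ⟨D, fun d hd => ?_⟩
    rw [hdet, smul_eq_mul, mul_comm, mul_assoc, ← zsmul_eq_mul]
    exact zsmul_mem (mul_mem_stdSpan_of_le _ (colMinor_mul_colMinor_mem_span _)
      (fun _ _ => FirstLT.of_le) hσ (hD d hd)) _

end Ideals

theorem stmt_6 (B : Type*) [CommRing B] (m n a t r : ℕ)
    (h1r : 1 ≤ r) (hrt : r ≤ t) (htm : t ≤ m) (htn : t ≤ n)
    (hra : r ≤ a) (han : a ≤ n) :
    -- J: t-minors with at least r columns among the first a columns
    Ideal.span {d | ∃ (f : Fin t → Fin m) (g : Fin t → Fin n),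
        StrictMono f ∧ StrictMono g ∧
        r ≤ (Finset.univ.filter fun i => ((g i : ℕ) < a)).card ∧
        d = ((genMat B m n).submatrix f g).det} =
    -- I_t(X)
    Ideal.span {d | ∃ (f : Fin t → Fin m) (g : Fin t → Fin n),
        StrictMono f ∧ StrictMono g ∧
        d = ((genMat B m n).submatrix f g).det} ⊓
    -- I_r(A), A = first a columns
    Ideal.span {d | ∃ (f : Fin r → Fin m) (g : Fin r → Fin n),
        StrictMono f ∧ StrictMono g ∧ (∀ i, (g i : ℕ) < a) ∧
        d = ((genMat B m n).submatrix f g).det} := by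
  apply le_antisymm
  · refine le_inf (Ideal.span_mono ?_) (Ideal.span_le.mpr ?_)
    · rintro _ ⟨f, g, hf, hg, -, rfl⟩
      exact ⟨f, g, hf, hg, rfl⟩
    · rintro _ ⟨f, g, hf, hg, hcard, rfl⟩
      refine det_mem_of_minors_mem _ hrt _ fun f' hf' => Ideal.subset_span
        ⟨f ∘ f', g ∘ Fin.castLE hrt, hf.comp hf', hg.comp (Fin.strictMono_castLE hrt), ?_, rfl⟩
      intro i
      by_contra! hi
      have hsub : (Finset.univ.filter fun i => ((g i : ℕ) < a)) ⊆
          Finset.Iio (Fin.castLE hrt i) := by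
        intro l hl
        rw [Finset.mem_filter] at hl
        rw [Finset.mem_Iio, ← hg.lt_iff_lt]
        exact hl.2.trans_le hi
      have := hcard.trans (Finset.card_le_card hsub)
      simp at this
      omega
  · rintro p ⟨hpt, hpr⟩
    obtain ⟨D, hD⟩ := exists_mem_stdSpan_of_mem_span B m n (k := t) (b := n)
      (by
        rintro _ ⟨f, g, hf, hg, rfl⟩
        exact ⟨f, g, hf, hg, fun i => (g i).2, rfl⟩) hpt
    obtain ⟨D', hD'⟩ := exists_mem_stdSpan_of_mem_span B m n (k := r) (b := a)
      (fun _ h => h) hpr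
    obtain ⟨c, hc, hcp⟩ := (Finsupp.mem_span_image_iff_linearCombination B).mp
      (hD (max D D') (le_max_left _ _))
    obtain ⟨c', hc', hcp'⟩ := (Finsupp.mem_span_image_iff_linearCombination B).mp
      (hD' (max D D') (le_max_right _ _))
    have hstd : ∀ (Q : ColSet m (n + m) → Prop) (d : ℕ),
        stdLists Q d ⊆ stdLists (fun _ => True) d :=
      fun Q d L hL => ⟨hL.1, hL.2.1, by simp⟩
    obtain rfl : c = c' := sub_eq_zero.mp <| linearIndepOn_iff.mp
      (linearIndepOn_extMat_minors B m n (max D D' + 1)) (c - c')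
      (sub_mem (Finsupp.supported_mono (hstd _ _) hc) (Finsupp.supported_mono (hstd _ _) hc'))
      (by rw [map_sub, hcp, hcp', sub_self])
    rw [← hcp, Finsupp.linearCombination_apply]
    refine sum_mem fun L hL => ?_
    obtain ⟨-, hlen, hLt⟩ := hc hL
    obtain ⟨-, -, hLr⟩ := hc' hL
    obtain ⟨α, L, rfl⟩ := List.exists_cons_of_length_eq_add_one hlen
    replace hLt : FirstLT t n α := hLt α (by simp)
    replace hLr : FirstLT r a α := hLr α (by simp)
    beta_reduce
    rw [List.map_cons, List.prod_cons, MvPolynomial.smul_eq_C_mul]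
    refine Ideal.mul_mem_left _ _ (Ideal.mul_mem_right _ _ ?_)
    refine det_mem_of_minors_mem _ htm _ fun f hf => Ideal.subset_span
      ⟨f, fun i => ⟨α.1 (Fin.castLE htm i), hLt _ (by simp)⟩, hf, fun i j hij => ?_, ?_, ?_⟩
    · exact Fin.lt_def.mp (α.2 (Fin.strictMono_castLE htm hij))
    · have := Finset.card_le_card_of_injOn (s := (Finset.univ : Finset (Fin r)))
        (t := Finset.univ.filter fun i : Fin t => (α.1 (Fin.castLE htm i) : ℕ) < a)
        (Fin.castLE hrt) (fun i _ => by simpa using hLr _ (by simp))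
        (Fin.castLE_injective hrt).injOn
      simpa using this
    · congr 1
      ext1 i j
      have : α.1 (Fin.castLE htm j) =
          Fin.castAdd m ⟨α.1 (Fin.castLE htm j), hLt _ (by simp)⟩ := rfl
      rw [Matrix.submatrix_apply, Matrix.submatrix_apply, this, extMat, Fin.append_left]
      rfl
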